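/- Let f1, f2, f3 be integers and k, ℓ, s, p nonnegative integers with f2−f3 ≥ 2, k ≤ f1−f2, p ≤ f1−f2, p+ℓ ≥ s, ℓ+k ≥ s, and f1−f2−k−p+s ≥ 0. Define 2U = f1−f2−k+ℓ, 2T = f2−f3+p+s−2, U−M_U = p−s+ℓ, U+M_U = f1−f2−k−p+s, T+M = f2−f3+p+ℓ+k−1, 2j1 = f1−f3−p+s−2, 2j2 = f2−f3+p−s+ℓ+k−2, 2j3 = ℓ+k, 2j = f1−f2. Then the q-Weyl coefficient satisfies ⟨U|T⟩_q = (−1)^k · U_q(j1 j2 j j3; U T), where U_q is the explicit q-Racah coefficient of su_q(2). That is, apart from the phase (−1)^k, the q-Weyl coefficient for the positive discrete series of u_q(2,1) coincides with a q-Racah coefficient of su_q(2). -/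

import Mathlib

noncomputable def qnum (q : ℝ) (n : ℤ) : ℝ := (q ^ n - q ^ (-n)) / (q - q⁻¹)

noncomputable def qfact (q : ℝ) : ℕ → ℝ
  | 0 => 1
  | n + 1 => qnum q ((n : ℤ) + 1) * qfact q n

/-- q-factorial of an integer argument. -/
noncomputable def qfactZ (q : ℝ) (n : ℤ) : ℝ := qfact q n.toNat

/-- q-number of a rational argument (used only at integer-valued rationals). -/
noncomputable def qnumQ (q : ℝ) (x : ℚ) : ℝ := qnum q ⌊x⌋

/-- q-factorial of a rational argument (used only at nonnegative integer-valued
rationals). -/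
noncomputable def qfactQ (q : ℝ) (x : ℚ) : ℝ := qfact q (⌊x⌋).toNat

/-- The explicit q-Racah coefficient `U_q(a b e d; c f)` of `su_q(2)` (formula (5.31) of
Asherova–Smirnov–Tolstoy), the sum running over all integers `n ≥ 0` for which every
q-factorial argument is nonnegative. -/
noncomputable def URacah (q : ℝ) (a b e d c f : ℚ) : ℝ :=
  (-1 : ℝ) ^ ⌊a + d - c - f⌋ *
    Real.sqrt (qnumQ q (2 * c + 1) * qnumQ q (2 * f + 1) * qfactQ q (a + b + c + 1) *
      qfactQ q (b + d + f + 1) * qfactQ q (a - b + c) * qfactQ q (-a + b + c) *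
      qfactQ q (a + e - f) * qfactQ q (b - d + f) * qfactQ q (-b + d + f) *
      qfactQ q (-c + d + e) /
      (qfactQ q (a + e + f + 1) * qfactQ q (c + d + e + 1) * qfactQ q (a + b - c) *
        qfactQ q (a - e + f) * qfactQ q (b + d - f) * qfactQ q (c + d - e) *
        qfactQ q (c - d + e) * qfactQ q (-a + e + f))) *
    ∑ n ∈ Finset.range ((⌊2 * b⌋).toNat + 1),
      if 0 ≤ 2 * b - n ∧ 0 ≤ b + c - e + f - n ∧ 0 ≤ b + c + e + f + 1 - n ∧
          0 ≤ -a + b + c - n ∧ 0 ≤ b - d + f - n ∧ 0 ≤ a + b + c + 1 - n ∧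
          0 ≤ b + d + f + 1 - n then
        (-1 : ℝ) ^ n * qfactQ q (2 * b - n) * qfactQ q (b + c - e + f - n) *
          qfactQ q (b + c + e + f + 1 - n) /
          (qfact q n * qfactQ q (-a + b + c - n) * qfactQ q (b - d + f - n) *
            qfactQ q (a + b + c + 1 - n) * qfactQ q (b + d + f + 1 - n))
      else 0

/-- The q-Weyl coefficient `⟨U|T⟩_q` (formula (113)) for the positive discrete series of
`u_q(2,1)` with lowest weight `(f1,f2,f3)`, expressed through the labels `k, ℓ, s, p` via
`2U = f1−f2−k+ℓ`, `2T = f2−f3+p+s−2`, `U−M_U = p−s+ℓ`, `U+M_U = f1−f2−k−p+s`,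
`T+M = f2−f3+p+ℓ+k−1`. -/
noncomputable def qWeyl (q : ℝ) (f1 f2 f3 : ℤ) (k l s p : ℕ) : ℝ :=
  Real.sqrt (qnum q (f1 - f2 - (k : ℤ) + (l : ℤ) + 1) *
      qnum q (f2 - f3 + (p : ℤ) + (s : ℤ) - 1) * qfact q k *
      qfactZ q ((l : ℤ) + (k : ℤ) - (s : ℤ)) *
      qfactZ q (f1 - f2 - (k : ℤ) - (p : ℤ) + (s : ℤ)) *
      qfactZ q (f2 - f3 + (p : ℤ) + (l : ℤ) + (k : ℤ) - 1) *
      qfactZ q (f1 - f2 - (k : ℤ)) * qfactZ q (f1 - f2 + (l : ℤ) + 1) *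
      qfactZ q (f2 - f3 + (s : ℤ) - 2) * qfactZ q (f2 - f3 + (p : ℤ) - 2) /
      (qfact q s * qfact q p * qfact q l * qfactZ q ((p : ℤ) - (s : ℤ) + (l : ℤ)) *
        qfactZ q (f1 - f3 + (s : ℤ) - 1) * qfactZ q (f1 - f2 - (p : ℤ)) *
        qfactZ q (f2 - f3 + (k : ℤ) - 2) * qfactZ q (f1 - f3 + (l : ℤ) - 1))) *
    ∑ n ∈ Finset.range (min k (l + k - s) + 1),
      (-1 : ℝ) ^ (k + n) *
        qfactZ q ((p : ℤ) - (s : ℤ) + (l : ℤ) + (k : ℤ) - (n : ℤ)) *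
        qfactZ q ((l : ℤ) + (k : ℤ) - (n : ℤ)) *
        qfactZ q (f1 - f3 + (l : ℤ) + (k : ℤ) - (n : ℤ) - 1) /
        (qfact q n * qfact q (k - n) * qfactZ q (f1 - f2 + (l : ℤ) + 1 - (n : ℤ)) *
          qfactZ q ((l : ℤ) + (k : ℤ) - (s : ℤ) - (n : ℤ)) *
          qfactZ q (f2 - f3 + (p : ℤ) + (l : ℤ) + (k : ℤ) - (n : ℤ) - 1))

/-- The reciprocal q-factorial of an integer, extended by `0` to negative arguments. -/
noncomputable def qfactInv (q : ℝ) (n : ℤ) : ℝ := if n < 0 then 0 else (qfactZ q n)⁻¹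

lemma qnum_zero (q : ℝ) : qnum q 0 = 0 := by simp [qnum]

lemma qnum_pos {q : ℝ} (hq : 0 < q) (hq1 : q ≠ 1) {n : ℤ} (hn : 0 < n) : 0 < qnum q n := by
  unfold qnum
  rcases lt_or_gt_of_ne hq1 with h | h
  · apply div_pos_of_neg_of_neg
    · have : q ^ n < q ^ (-n) := zpow_lt_zpow_right_of_lt_one₀ hq h (by lia)
      linarith
    · have : 1 < q⁻¹ := (one_lt_inv₀ hq).2 h
      linarith
  · apply div_pos
    · have : q ^ (-n) < q ^ n := zpow_lt_zpow_right₀ h (by lia)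
      linarith
    · have : q⁻¹ < 1 := inv_lt_one_of_one_lt₀ h
      linarith

lemma qfact_pos {q : ℝ} (hq : 0 < q) (hq1 : q ≠ 1) (n : ℕ) : 0 < qfact q n := by
  induction n with
  | zero => simp [qfact]
  | succ n ih => exact mul_pos (qnum_pos hq hq1 (by lia)) ih

lemma qfactZ_pos {q : ℝ} (hq : 0 < q) (hq1 : q ≠ 1) (n : ℤ) : 0 < qfactZ q n :=
  qfact_pos hq hq1 _

lemma qfactZ_add_one (q : ℝ) {n : ℤ} (hn : 0 ≤ n) :
    qfactZ q (n + 1) = qnum q (n + 1) * qfactZ q n := by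
  lift n to ℕ using hn
  have : ((n : ℤ) + 1).toNat = n + 1 := by lia
  simp [qfactZ, this, qfact]

lemma qfactZ_natCast (q : ℝ) (n : ℕ) : qfactZ q n = qfact q n := by simp [qfactZ]

lemma qfactInv_of_neg (q : ℝ) {n : ℤ} (hn : n < 0) : qfactInv q n = 0 := by simp [qfactInv, hn]

lemma qfactInv_of_nonneg (q : ℝ) {n : ℤ} (hn : 0 ≤ n) : qfactInv q n = (qfactZ q n)⁻¹ := by
  simp [qfactInv, not_lt.2 hn]

lemma qfactInv_zero (q : ℝ) : qfactInv q 0 = 1 := by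
  simp [qfactInv, qfactZ, qfact]

lemma qfactInv_sub_one {q : ℝ} (hq : 0 < q) (hq1 : q ≠ 1) (n : ℤ) :
    qfactInv q (n - 1) = qnum q n * qfactInv q n := by
  rcases lt_trichotomy n 0 with h | rfl | h
  · rw [qfactInv_of_neg q h, qfactInv_of_neg q (by lia), mul_zero]
  · rw [qfactInv_of_neg q (by lia), qnum_zero, zero_mul]
  · rw [qfactInv_of_nonneg q (by lia), qfactInv_of_nonneg q h.le]
    have h1 := qfactZ_add_one q (n := n - 1) (by lia)
    rw [sub_add_cancel] at h1
    have h2 := (qfactZ_pos hq hq1 (n - 1)).ne'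
    have h3 := (qnum_pos hq hq1 h).ne'
    rw [h1]
    field_simp

lemma qfactZ_mul_qfactInv {q : ℝ} (hq : 0 < q) (hq1 : q ≠ 1) {n : ℤ} (hn : 0 ≤ n) :
    qfactZ q n * qfactInv q n = 1 := by
  rw [qfactInv_of_nonneg q hn, mul_inv_cancel₀ (qfactZ_pos hq hq1 n).ne']

lemma qnum_identity_unsigned {q : ℝ} (hq : 0 < q) (n r x y w : ℤ) :
    qnum q (n + 1) * qnum q (x + y + w - n) * qnum q (w - n + r) -
        qnum q (w + y - n) * qnum q (w + x - n) * qnum q (n + 1 - r) =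
      qnum q (x + y + w - r + 1) * qnum q r * qnum q (w - n + r) -
        qnum q (n + 1 - r) * qnum q (x - r) * qnum q (y - r) := by
  have hq0 := hq.ne'
  simp only [qnum, zpow_add₀ hq0, zpow_sub₀ hq0, zpow_neg, zpow_one]
  generalize (q - q⁻¹) = D
  have hn : q ^ n ≠ 0 := zpow_ne_zero _ hq0
  have hr : q ^ r ≠ 0 := zpow_ne_zero _ hq0
  have hx : q ^ x ≠ 0 := zpow_ne_zero _ hq0
  have hy : q ^ y ≠ 0 := zpow_ne_zero _ hq0
  have hw : q ^ w ≠ 0 := zpow_ne_zero _ hq0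
  generalize q ^ n = N at *
  generalize q ^ r = R at *
  generalize q ^ x = X at *
  generalize q ^ y = Y at *
  generalize q ^ w = W at *
  simp only [div_eq_mul_inv]
  generalize D⁻¹ = E
  field_simp
  ring

lemma qnum_identity_signed {q : ℝ} (hq : 0 < q) (a b c d m : ℤ) :
    qnum q (a + 1) * qnum q (b + c - a) * qnum q (b + d - a) * qnum q (b + c + d + 1 - a - m) -
        qnum q (c - a) * qnum q (d - a) * qnum q (b + c + d + 1 - a) * qnum q (a + 1 - m) =
      qnum q (b + c + d - 2 * a) *
        (qnum q (a + 1 - m) * qnum q (b - m) * qnum q (b + c + d + 1 - a - m) +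
          qnum q (b + c - m + 1) * qnum q (b + d - m + 1) * qnum q m) := by
  have hq0 := hq.ne'
  simp only [qnum, two_mul, zpow_add₀ hq0, zpow_sub₀ hq0, zpow_neg, zpow_one]
  generalize (q - q⁻¹) = D
  have ha : q ^ a ≠ 0 := zpow_ne_zero _ hq0
  have hb : q ^ b ≠ 0 := zpow_ne_zero _ hq0
  have hc : q ^ c ≠ 0 := zpow_ne_zero _ hq0
  have hd : q ^ d ≠ 0 := zpow_ne_zero _ hq0
  have hm : q ^ m ≠ 0 := zpow_ne_zero _ hq0
  generalize q ^ a = A at *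
  generalize q ^ b = B at *
  generalize q ^ c = C at *
  generalize q ^ d = U at *
  generalize q ^ m = M at *
  simp only [div_eq_mul_inv]
  generalize D⁻¹ = E
  field_simp
  ring

/-- The q-Pfaff–Saalschütz summation with one factorial in the numerator. -/
lemma saalschutz_unsigned {q : ℝ} (hq : 0 < q) (hq1 : q ≠ 1) {x y w : ℤ} (hx : 0 ≤ x)
    (hy : 0 ≤ y) (hw : 0 ≤ w) (n : ℕ) (hnx : n ≤ w + x) (hny : n ≤ w + y) :
    ∑ r ∈ Finset.range (n + 1), qfactZ q (x + y + w - r) * qfactInv q r * qfactInv q (n - r) *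
        qfactInv q (x - r) * qfactInv q (y - r) * qfactInv q (w - n + r) =
      qfactZ q (x + y + w - n) * qfactZ q (w + x) * qfactZ q (w + y) * qfactInv q n *
        qfactInv q (w + x - n) * qfactInv q (w + y - n) * qfactInv q x * qfactInv q y *
        qfactInv q w := by
  induction n with
  | zero =>
    have h1 := qfactZ_mul_qfactInv hq hq1 (n := w + x) (by lia)
    have h2 := qfactZ_mul_qfactInv hq hq1 (n := w + y) (by lia)
    simp only [zero_add, Finset.sum_range_one, Nat.cast_zero, sub_zero, add_zero, qfactInv_zero]
    linear_combination (-qfactZ q (x + y + w) * qfactInv q x * qfactInv q y * qfactInv q w) *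
      (qfactZ q (w + y) * qfactInv q (w + y) * h1 + h2)
  | succ n ih =>
    push_cast at hnx hny ⊢
    have ih := ih (by lia) (by lia)
    have step (r : ℤ) :
        qnum q (n + 1) * qnum q (x + y + w - n) *
            (qfactZ q (x + y + w - r) * qfactInv q r * qfactInv q (n + 1 - r) *
              qfactInv q (x - r) * qfactInv q (y - r) * qfactInv q (w - (n + 1) + r)) -
          qnum q (w + y - n) * qnum q (w + x - n) *
            (qfactZ q (x + y + w - r) * qfactInv q r * qfactInv q (n - r) *
              qfactInv q (x - r) * qfactInv q (y - r) * qfactInv q (w - n + r)) =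
        qfactZ q (x + y + w - r + 1) * qfactInv q (r - 1) * qfactInv q (n + 1 - r) *
            qfactInv q (x - r) * qfactInv q (y - r) * qfactInv q (w - n - 1 + r) -
          qfactZ q (x + y + w - r) * qfactInv q r * qfactInv q (n + 1 - (r + 1)) *
            qfactInv q (x - (r + 1)) * qfactInv q (y - (r + 1)) *
            qfactInv q (w - n - 1 + (r + 1)) := by
      by_cases hrx : r ≤ x
      swap
      · rw [qfactInv_of_neg q (n := x - r) (by lia), qfactInv_of_neg q (n := x - (r + 1)) (by lia)]
        ring
      have e1 : qfactInv q (w - (n + 1) + r) = qnum q (w - n + r) * qfactInv q (w - n + r) := by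
        rw [← qfactInv_sub_one hq hq1]; congr 1; ring
      have e2 : qfactInv q (w - n - 1 + r) = qnum q (w - n + r) * qfactInv q (w - n + r) := by
        rw [← qfactInv_sub_one hq hq1]; congr 1; ring
      have e3 : qfactInv q (n - r) = qnum q (n + 1 - r) * qfactInv q (n + 1 - r) := by
        rw [← qfactInv_sub_one hq hq1]; congr 1; ring
      have e4 : qfactInv q (n + 1 - (r + 1)) = qnum q (n + 1 - r) * qfactInv q (n + 1 - r) := by
        rw [← qfactInv_sub_one hq hq1]; congr 1; ring
      have e5 : qfactInv q (x - (r + 1)) = qnum q (x - r) * qfactInv q (x - r) := by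
        rw [← qfactInv_sub_one hq hq1]; congr 1; ring
      have e6 : qfactInv q (y - (r + 1)) = qnum q (y - r) * qfactInv q (y - r) := by
        rw [← qfactInv_sub_one hq hq1]; congr 1; ring
      have e7 : w - n - 1 + (r + 1) = w - n + r := by ring
      rw [e1, e2, e3, e4, e5, e6, e7, qfactInv_sub_one hq hq1 r,
        qfactZ_add_one q (n := x + y + w - r) (by lia)]
      linear_combination qfactZ q (x + y + w - r) * qfactInv q r * qfactInv q (n + 1 - r) *
        qfactInv q (x - r) * qfactInv q (y - r) * qfactInv q (w - n + r) *
        qnum_identity_unsigned hq n r x y w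
    have tele := Finset.sum_range_sub' (fun r : ℕ =>
      qfactZ q (x + y + w - r + 1) * qfactInv q (r - 1) * qfactInv q (n + 1 - r) *
            qfactInv q (x - r) * qfactInv q (y - r) * qfactInv q (w - n - 1 + r)) (n + 2)
    have lhs := Finset.sum_congr (rfl : Finset.range (n + 2) = Finset.range (n + 2))
      (fun r _ => step r)
    have hs (r : ℤ) : x + y + w - (r + 1) + 1 = x + y + w - r := by ring
    push_cast at tele
    simp only [hs, add_sub_cancel_right] at tele
    rw [tele, Finset.sum_sub_distrib, ← Finset.mul_sum, ← Finset.mul_sum,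
      Finset.sum_range_succ (n := n + 1) (f := fun r : ℕ =>
        qfactZ q (x + y + w - r) * qfactInv q r * qfactInv q (n - r) *
        qfactInv q (x - r) * qfactInv q (y - r) * qfactInv q (w - n + r)), ih,
      qfactInv_of_neg q (n := -1) (by lia),
      qfactInv_of_neg q (n := (n : ℤ) - (n + 1 : ℕ)) (by push_cast; lia),
      qfactInv_of_neg q (n := (n : ℤ) + 1 - (n + 2)) (by lia)] at lhs
    have hA : qnum q (n + 1) * qnum q (x + y + w - n) ≠ 0 :=
      mul_ne_zero (qnum_pos hq hq1 (by lia)).ne' (qnum_pos hq hq1 (by lia)).ne'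
    apply mul_left_cancel₀ hA
    have e1 : qfactInv q n = qnum q (n + 1) * qfactInv q (n + 1) := by
      rw [← qfactInv_sub_one hq hq1]; congr 1; ring
    have e2 : qfactInv q (w + x - (n + 1)) = qnum q (w + x - n) * qfactInv q (w + x - n) := by
      rw [← qfactInv_sub_one hq hq1]; congr 1; ring
    have e3 : qfactInv q (w + y - (n + 1)) = qnum q (w + y - n) * qfactInv q (w + y - n) := by
      rw [← qfactInv_sub_one hq hq1]; congr 1; ring
    have e4 : qfactZ q (x + y + w - n) =
        qnum q (x + y + w - n) * qfactZ q (x + y + w - (n + 1)) := by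
      have := qfactZ_add_one q (n := x + y + w - (n + 1)) (by lia)
      rwa [hs] at this
    rw [e1, e4] at lhs
    rw [e2, e3]
    linear_combination lhs

/-- The q-Pfaff–Saalschütz summation with two factorials in the numerator. -/
lemma saalschutz_signed {q : ℝ} (hq : 0 < q) (hq1 : q ≠ 1) {b c d : ℤ}
    (hc : 0 ≤ c) (hd : 0 ≤ d) (a : ℕ) (hac : a ≤ b + c) (had : a ≤ b + d) :
    ∑ m ∈ Finset.range (a + 1), (-1 : ℝ) ^ m * qfactZ q (b + c - m) * qfactZ q (b + d - m) *
        qfactInv q m * qfactInv q (a - m) * qfactInv q (b - m) *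
        qfactInv q (b + c + d + 1 - a - m) =
      qfactZ q c * qfactZ q d * qfactZ q (b + c - a) * qfactZ q (b + d - a) *
        qfactInv q (c - a) * qfactInv q (d - a) * qfactInv q a * qfactInv q b *
        qfactInv q (b + c + d + 1 - a) := by
  induction a with
  | zero =>
    have h1 := qfactZ_mul_qfactInv hq hq1 hc
    have h2 := qfactZ_mul_qfactInv hq hq1 hd
    simp only [zero_add, Finset.sum_range_one, Nat.cast_zero, sub_zero, qfactInv_zero, pow_zero]
    linear_combination (-qfactZ q (b + c) * qfactZ q (b + d) * qfactInv q b *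
      qfactInv q (b + c + d + 1)) * (qfactZ q d * qfactInv q d * h1 + h2)
  | succ a ih =>
    push_cast at hac had ⊢
    have ih := ih (by lia) (by lia)
    have step (m : ℕ) :
        qnum q (a + 1) * qnum q (b + c - a) * qnum q (b + d - a) *
            ((-1 : ℝ) ^ m * qfactZ q (b + c - m) * qfactZ q (b + d - m) *
              qfactInv q m * qfactInv q (a + 1 - m) * qfactInv q (b - m) *
              qfactInv q (b + c + d + 1 - (a + 1) - m)) -
          qnum q (c - a) * qnum q (d - a) * qnum q (b + c + d + 1 - a) *
            ((-1 : ℝ) ^ m * qfactZ q (b + c - m) * qfactZ q (b + d - m) *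
              qfactInv q m * qfactInv q (a - m) * qfactInv q (b - m) *
              qfactInv q (b + c + d + 1 - a - m)) =
        qnum q (b + c + d - 2 * a) *
         ((-1 : ℝ) ^ m * qfactZ q (b + c - m + 1) * qfactZ q (b + d - m + 1) *
            qfactInv q (m - 1) * qfactInv q (a + 1 - m) * qfactInv q (b - m) *
            qfactInv q (b + c + d + 1 - a - m) -
          (-1 : ℝ) ^ (m + 1) * qfactZ q (b + c - m) * qfactZ q (b + d - m) *
            qfactInv q m * qfactInv q (a + 1 - (m + 1)) * qfactInv q (b - (m + 1)) *
            qfactInv q (b + c + d + 1 - a - (m + 1))) := by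
      by_cases hmb : m ≤ b
      swap
      · rw [qfactInv_of_neg q (n := b - m) (by lia), qfactInv_of_neg q (n := b - (m + 1)) (by lia)]
        ring
      have e1 : qfactInv q (b + c + d + 1 - (a + 1) - m) =
          qnum q (b + c + d + 1 - a - m) * qfactInv q (b + c + d + 1 - a - m) := by
        rw [← qfactInv_sub_one hq hq1]; congr 1; ring
      have e2 : qfactInv q (b + c + d + 1 - a - (m + 1)) =
          qnum q (b + c + d + 1 - a - m) * qfactInv q (b + c + d + 1 - a - m) := by
        rw [← qfactInv_sub_one hq hq1]; congr 1; ring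
      have e3 : qfactInv q (a - m) = qnum q (a + 1 - m) * qfactInv q (a + 1 - m) := by
        rw [← qfactInv_sub_one hq hq1]; congr 1; ring
      have e4 : qfactInv q (a + 1 - (m + 1)) = qnum q (a + 1 - m) * qfactInv q (a + 1 - m) := by
        rw [← qfactInv_sub_one hq hq1]; congr 1; ring
      have e5 : qfactInv q (b - (m + 1)) = qnum q (b - m) * qfactInv q (b - m) := by
        rw [← qfactInv_sub_one hq hq1]; congr 1; ring
      rw [e1, e2, e3, e4, e5, qfactInv_sub_one hq hq1 m,
        qfactZ_add_one q (n := b + c - m) (by lia), qfactZ_add_one q (n := b + d - m) (by lia)]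
      linear_combination (-1 : ℝ) ^ m * qfactZ q (b + c - m) * qfactZ q (b + d - m) *
        qfactInv q m * qfactInv q (a + 1 - m) * qfactInv q (b - m) *
        qfactInv q (b + c + d + 1 - a - m) * qnum_identity_signed hq a b c d m
    have tele := Finset.sum_range_sub' (fun m : ℕ =>
      (-1 : ℝ) ^ m * qfactZ q (b + c - m + 1) * qfactZ q (b + d - m + 1) *
            qfactInv q (m - 1) * qfactInv q (a + 1 - m) * qfactInv q (b - m) *
            qfactInv q (b + c + d + 1 - a - m)) (a + 2)
    have lhs := Finset.sum_congr (rfl : Finset.range (a + 2) = Finset.range (a + 2))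
      (fun m _ => step m)
    have hs (z r : ℤ) : z - (r + 1) + 1 = z - r := by ring
    push_cast at tele
    simp only [hs, add_sub_cancel_right] at tele
    rw [← Finset.mul_sum, tele, Finset.sum_sub_distrib, ← Finset.mul_sum, ← Finset.mul_sum,
      Finset.sum_range_succ (n := a + 1) (f := fun m : ℕ =>
        (-1 : ℝ) ^ m * qfactZ q (b + c - m) * qfactZ q (b + d - m) *
        qfactInv q m * qfactInv q (a - m) * qfactInv q (b - m) *
        qfactInv q (b + c + d + 1 - a - m)), ih,
      qfactInv_of_neg q (n := -1) (by lia),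
      qfactInv_of_neg q (n := (a : ℤ) - (a + 1 : ℕ)) (by push_cast; lia),
      qfactInv_of_neg q (n := (a : ℤ) + 1 - (a + 2)) (by lia)] at lhs
    have hA : qnum q (a + 1) * qnum q (b + c - a) * qnum q (b + d - a) ≠ 0 :=
      mul_ne_zero (mul_ne_zero (qnum_pos hq hq1 (by lia)).ne' (qnum_pos hq hq1 (by lia)).ne')
        (qnum_pos hq hq1 (by lia)).ne'
    apply mul_left_cancel₀ hA
    have e1 : qfactInv q a = qnum q (a + 1) * qfactInv q (a + 1) := by
      rw [← qfactInv_sub_one hq hq1]; congr 1; ring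
    have e2 : qfactInv q (c - (a + 1)) = qnum q (c - a) * qfactInv q (c - a) := by
      rw [← qfactInv_sub_one hq hq1]; congr 1; ring
    have e3 : qfactInv q (d - (a + 1)) = qnum q (d - a) * qfactInv q (d - a) := by
      rw [← qfactInv_sub_one hq hq1]; congr 1; ring
    have e4 : qfactZ q (b + c - a) = qnum q (b + c - a) * qfactZ q (b + c - (a + 1)) := by
      have := qfactZ_add_one q (n := b + c - (a + 1)) (by lia)
      rwa [hs] at this
    have e5 : qfactZ q (b + d - a) = qnum q (b + d - a) * qfactZ q (b + d - (a + 1)) := by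
      have := qfactZ_add_one q (n := b + d - (a + 1)) (by lia)
      rwa [hs] at this
    have e6 : qfactInv q (b + c + d + 1 - (a + 1)) =
        qnum q (b + c + d + 1 - a) * qfactInv q (b + c + d + 1 - a) := by
      rw [← qfactInv_sub_one hq hq1]; congr 1; ring
    rw [e1, e4, e5] at lhs
    rw [e2, e3, e6]
    linear_combination lhs

lemma saalschutz_signed_shift {q : ℝ} (hq : 0 < q) (hq1 : q ≠ 1) {b c d : ℤ}
    (hc : 0 ≤ c) (hd : 0 ≤ d) (a r : ℕ) (hra : r ≤ a) (hac : a ≤ b + c) (had : a ≤ b + d) :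
    ∑ m ∈ Finset.range (a + 1 - r), (-1 : ℝ) ^ m * qfactZ q (b + c - (r + m)) *
        qfactZ q (b + d - (r + m)) * qfactInv q m * qfactInv q (a - (r + m)) *
        qfactInv q (b - (r + m)) * qfactInv q (b + c + d + 1 - a - m) =
      qfactZ q c * qfactZ q d * qfactZ q (b + c - a) * qfactZ q (b + d - a) *
        qfactInv q (c - a + r) * qfactInv q (d - a + r) * qfactInv q (a - r) *
        qfactInv q (b - r) * qfactInv q (b + c + d + 1 - a) := by
  by_cases hrb : r ≤ b
  swap
  · rw [qfactInv_of_neg q (n := b - r) (by lia), mul_zero, zero_mul]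
    refine Finset.sum_eq_zero fun m _ => ?_
    rw [qfactInv_of_neg q (n := b - (r + m)) (by lia), mul_zero, zero_mul]
  have key := saalschutz_signed hq hq1 (b := b - r) hc hd (a - r) (by lia) (by lia)
  rw [Nat.cast_sub hra] at key
  have hr : a - r + 1 = a + 1 - r := by lia
  have e1 (z m : ℤ) : b - r + z - m = b + z - (r + m) := by ring
  have e2 (z m : ℤ) : z - r - m = z - (r + m) := by ring
  have e3 : b - r + c + d + 1 - (a - r) = b + c + d + 1 - a := by ring
  have e4 (z : ℤ) : b - r + z - (a - r) = b + z - a := by ring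
  have e5 (z : ℤ) : z - (a - r) = z - a + r := by ring
  simp only [e3, hr, e4, e5] at key
  simpa only [e1, e2] using key

/-- A Whipple-type transformation of a terminating balanced q-hypergeometric sum with three
factorials in the numerator into a Racah-type sum with a single one. -/
lemma whipple_racah {q : ℝ} (hq : 0 < q) (hq1 : q ≠ 1) {b c d x y w : ℤ}
    (hc : 0 ≤ c) (hd : 0 ≤ d) (hx : 0 ≤ x) (hy : 0 ≤ y) (a : ℕ) (hw : w = b + c + d + 1 - a)
    (hac : a ≤ b + c) (had : a ≤ b + d) (hax : a ≤ w + x) (hay : a ≤ w + y) :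
    qfactZ q (w + x) * qfactZ q (w + y) *
      ∑ n ∈ Finset.range (a + 1), (-1 : ℝ) ^ n * qfactZ q (b + c - n) * qfactZ q (b + d - n) *
        qfactZ q (x + y + w - n) * qfactInv q n * qfactInv q (a - n) * qfactInv q (b - n) *
        qfactInv q (w + x - n) * qfactInv q (w + y - n) =
      qfactZ q x * qfactZ q y * qfactZ q c * qfactZ q d * qfactZ q (b + c - a) *
        qfactZ q (b + d - a) *
      ∑ r ∈ Finset.range (a + 1), (-1 : ℝ) ^ r * qfactZ q (x + y + w - r) * qfactInv q r *
        qfactInv q (a - r) * qfactInv q (b - r) * qfactInv q (x - r) * qfactInv q (y - r) *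
        qfactInv q (c - a + r) * qfactInv q (d - a + r) := by
  have hw0 : 0 ≤ w := by lia
  have hZx := qfactZ_mul_qfactInv hq hq1 hx
  have hZy := qfactZ_mul_qfactInv hq hq1 hy
  have hZw := qfactZ_mul_qfactInv hq hq1 hw0
  let f (r m : ℕ) : ℝ := (qfactZ q x * qfactZ q y * qfactZ q w * (-1) ^ r *
    qfactZ q (x + y + w - r) * qfactInv q r * qfactInv q (x - r) * qfactInv q (y - r)) *
    ((-1) ^ m * qfactZ q (b + c - (r + m)) *
        qfactZ q (b + d - (r + m)) * qfactInv q m * qfactInv q (a - (r + m)) *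
        qfactInv q (b - (r + m)) * qfactInv q (w - m))
  calc _ = ∑ n ∈ Finset.range (a + 1), ∑ r ∈ Finset.range (n + 1), f r (n - r) := by
        rw [Finset.mul_sum]
        refine Finset.sum_congr rfl fun n hn => ?_
        have hn := Finset.mem_range.1 hn
        have key := saalschutz_unsigned hq hq1 hx hy hw0 n (by lia) (by lia)
        have h1 : ∑ r ∈ Finset.range (n + 1), f r (n - r) =
            ((-1) ^ n * qfactZ q (b + c - n) * qfactZ q (b + d - n) * qfactInv q (a - n) *
              qfactInv q (b - n) * qfactZ q x * qfactZ q y * qfactZ q w) *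
            ∑ r ∈ Finset.range (n + 1), qfactZ q (x + y + w - r) * qfactInv q r *
              qfactInv q (n - r) * qfactInv q (x - r) * qfactInv q (y - r) *
              qfactInv q (w - n + r) := by
          rw [Finset.mul_sum]
          refine Finset.sum_congr rfl fun r hr => ?_
          have hr : r ≤ n := by have := Finset.mem_range.1 hr; lia
          have e1 : (r : ℤ) + (n - r : ℤ) = n := by ring
          have e2 : w - (n - r : ℤ) = w - n + r := by ring
          have e3 : (-1 : ℝ) ^ n = (-1) ^ r * (-1) ^ (n - r) := by
            rw [← pow_add]; congr 1; lia
          simp only [f]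
          rw [Nat.cast_sub hr, e1, e2, e3]
          ring
        rw [h1, key]
        linear_combination (-(-1 : ℝ) ^ n * qfactZ q (b + c - n) * qfactZ q (b + d - n) *
          qfactZ q (x + y + w - n) * qfactInv q n * qfactInv q (a - n) * qfactInv q (b - n) *
          qfactInv q (w + x - n) * qfactInv q (w + y - n) * qfactZ q (w + x) * qfactZ q (w + y)) *
          (qfactZ q y * qfactInv q y * qfactZ q w * qfactInv q w * hZx +
            qfactZ q w * qfactInv q w * hZy + hZw)
    _ = ∑ r ∈ Finset.range (a + 1), ∑ m ∈ Finset.range (a + 1 - r), f r m :=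
        Finset.sum_range_diag_flip _ _
    _ = _ := by
        rw [Finset.mul_sum]
        refine Finset.sum_congr rfl fun r hr => ?_
        have hr : r ≤ a := by have := Finset.mem_range.1 hr; lia
        have key := saalschutz_signed_shift hq hq1 hc hd a r hr hac had
        rw [← hw] at key
        simp only [f]
        rw [← Finset.mul_sum, key]
        linear_combination ((-1 : ℝ) ^ r * qfactZ q (x + y + w - r) * qfactInv q r *
          qfactInv q (a - r) * qfactInv q (b - r) * qfactInv q (x - r) * qfactInv q (y - r) *
          qfactInv q (c - a + r) * qfactInv q (d - a + r) * qfactZ q x * qfactZ q y *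
          qfactZ q c * qfactZ q d * qfactZ q (b + c - a) * qfactZ q (b + d - a)) * hZw

lemma sum_range_eq_sum_range_of_eq_zero {f : ℕ → ℝ} {A B : ℕ}
    (h : ∀ n, A ≤ n ∨ B ≤ n → f n = 0) :
    ∑ n ∈ Finset.range A, f n = ∑ n ∈ Finset.range B, f n := by
  wlog hAB : A ≤ B generalizing A B
  · exact (this (fun n hn => h n hn.symm) (by lia)).symm
  · refine Finset.sum_subset (Finset.range_subset_range.2 hAB) fun n _ hn => h n (Or.inl ?_)
    simpa using hn

/-- The two sums entering the q-Weyl and the q-Racah coefficients are proportional. -/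
lemma weyl_sum_racah_sum {q : ℝ} (hq : 0 < q) (hq1 : q ≠ 1) {N g : ℤ} {k l s p a : ℕ}
    (hg : 0 ≤ g) (hk : k ≤ N) (hp : p ≤ N) (ha : (a : ℤ) = p - s + l) (hlks : (s : ℤ) ≤ l + k) :
    (-1 : ℝ) ^ k * qfactZ q (l + k - s) * qfactZ q (N - k) * qfactZ q (N + l + 1) *
        qfactZ q (g + s) *
      ∑ n ∈ Finset.range (k + 1), (-1 : ℝ) ^ n * qfactZ q (l + k - n) *
        qfactZ q (p - s + l + k - n) * qfactZ q (N + g + l + k + 1 - n) * qfactInv q n *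
        qfactInv q (k - n) * qfactInv q (l + k - s - n) * qfactInv q (N + l + 1 - n) *
        qfactInv q (g + p + l + k + 1 - n) =
    (-1 : ℝ) ^ p * qfactZ q (p - s + l) * qfactZ q (N + g + l + 1) * qfactZ q (N - p) *
        qfactZ q s *
      ∑ n ∈ Finset.range (a + 1), (-1 : ℝ) ^ n * qfactZ q (g + p + l + k - s - n) *
        qfactZ q (g + p + l - n) * qfactZ q (N + g + p + l + 1 - n) * qfactInv q n *
        qfactInv q (p - s + l - n) * qfactInv q (g + p - n) *
        qfactInv q (g + p + l + k + 1 - n) * qfactInv q (N + g + l + 1 - n) := by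
  have h1 := whipple_racah hq hq1 (b := l + k - s) (c := s) (d := p) (x := N - p) (y := g + k)
    (w := l + p + 1) (by lia) (by lia) (by lia) (by lia) k (by ring) (by lia) (by lia) (by lia)
    (by lia)
  have h2 := whipple_racah hq hq1 (b := g + p) (c := l + k - s) (d := l) (x := p) (y := N - k)
    (w := g + l + k + 1) (by lia) (by lia) (by lia) (by lia) a (by lia) (by lia) (by lia)
    (by lia) (by lia)
  rw [ha] at h2
  have t1 : (l : ℤ) + p + 1 + (N - p) = N + l + 1 := by ring
  have t2 : (l : ℤ) + p + 1 + (g + k) = g + p + l + k + 1 := by ring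
  have t3 : (l : ℤ) + k - s + s = l + k := by ring
  have t4 : (l : ℤ) + k - s + p = p - s + l + k := by ring
  have t5 : N - p + (g + k) + (l + p + 1) = N + g + l + k + 1 := by ring
  have t6 : (l : ℤ) + k - k = l := by ring
  have t7 : (p : ℤ) - s + l + k - k = p - s + l := by ring
  simp only [t1, t2, t3, t4, t5, t6, t7] at h1
  have u1 : g + l + k + 1 + (p : ℤ) = g + p + l + k + 1 := by ring
  have u2 : g + l + k + 1 + (N - k) = N + g + l + 1 := by ring
  have u3 : g + p + (l + k - s) = g + p + l + k - s := by ring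
  have u4 : p + (N - k) + (g + l + k + 1) = N + g + p + l + 1 := by ring
  have u5 : g + p + l + k - s - (p - s + l) = g + k := by ring
  have u6 : g + p + l - (p - s + l) = g + s := by ring
  have u7 (r : ℤ) : l + k - s - (p - s + l) + r = k - p + r := by ring
  have u8 (r : ℤ) : l - (p - s + l) + r = s - p + r := by ring
  simp only [u1, u2, u3, u4, u5, u6, u7, u8] at h2
  set W := ∑ n ∈ Finset.range (k + 1), (-1 : ℝ) ^ n * qfactZ q (l + k - n) *
        qfactZ q (p - s + l + k - n) * qfactZ q (N + g + l + k + 1 - n) * qfactInv q n *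
        qfactInv q (k - n) * qfactInv q (l + k - s - n) * qfactInv q (N + l + 1 - n) *
        qfactInv q (g + p + l + k + 1 - n) with hW
  set R := ∑ n ∈ Finset.range (a + 1), (-1 : ℝ) ^ n * qfactZ q (g + p + l + k - s - n) *
        qfactZ q (g + p + l - n) * qfactZ q (N + g + p + l + 1 - n) * qfactInv q n *
        qfactInv q (p - s + l - n) * qfactInv q (g + p - n) *
        qfactInv q (g + p + l + k + 1 - n) * qfactInv q (N + g + l + 1 - n) with hR
  set Q1 := ∑ r ∈ Finset.range (k + 1), (-1 : ℝ) ^ r * qfactZ q (N + g + l + k + 1 - r) *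
        qfactInv q r * qfactInv q (k - r) * qfactInv q (l + k - s - r) * qfactInv q (N - p - r) *
        qfactInv q (g + k - r) * qfactInv q (s - k + r) * qfactInv q (p - k + r) with hQ1
  set Q2 := ∑ r ∈ Finset.range (a + 1), (-1 : ℝ) ^ r * qfactZ q (N + g + p + l + 1 - r) *
        qfactInv q r * qfactInv q (p - s + l - r) * qfactInv q (g + p - r) * qfactInv q (p - r) *
        qfactInv q (N - k - r) * qfactInv q (k - p + r) * qfactInv q (s - p + r) with hQ2
  let f (z : ℕ) : ℝ := (-1) ^ z * qfactZ q (N + g + l + 1 + z) * qfactInv q z *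
    qfactInv q (k - z) * qfactInv q (p - z) * qfactInv q (s - z) * qfactInv q (l - s + z) *
    qfactInv q (N - p - k + z) * qfactInv q (g + z)
  have hQ1' : (-1) ^ k * Q1 = ∑ z ∈ Finset.range (k + 1), f z := by
    rw [← Finset.sum_range_reflect, hQ1, Finset.mul_sum]
    refine Finset.sum_congr rfl fun r hr => ?_
    have hr : r ≤ k := by have := Finset.mem_range.1 hr; lia
    have e0 : k + 1 - 1 - r = k - r := by lia
    have e1 : N + g + l + 1 + ((k : ℤ) - r) = N + g + l + k + 1 - r := by ring
    have e2 (z : ℤ) : z - ((k : ℤ) - r) = z - k + r := by ring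
    have e3 : (l : ℤ) - s + (k - r) = l + k - s - r := by ring
    have e4 : N - p - k + ((k : ℤ) - r) = N - p - r := by ring
    have e5 : g + ((k : ℤ) - r) = g + k - r := by ring
    have e6 : (-1 : ℝ) ^ k = (-1) ^ r * (-1) ^ (k - r) := by
      rw [← pow_add]; congr 1; lia
    have e7 : (-1 : ℝ) ^ r * (-1) ^ r = 1 := by rw [← mul_pow]; simp
    simp only [f]
    rw [e0, Nat.cast_sub hr, e1, e2, e2, e2, e3, e4, e5, e6, sub_self, zero_add]
    linear_combination ((-1 : ℝ) ^ (k - r) * qfactZ q (N + g + l + k + 1 - r) *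
        qfactInv q r * qfactInv q (k - r) * qfactInv q (l + k - s - r) * qfactInv q (N - p - r) *
        qfactInv q (g + k - r) * qfactInv q (s - k + r) * qfactInv q (p - k + r)) * e7
  have hQ2' : (-1) ^ p * Q2 = ∑ z ∈ Finset.range (p + 1), f z := by
    rw [← Finset.sum_range_reflect, hQ2, sum_range_eq_sum_range_of_eq_zero (B := p + 1),
      Finset.mul_sum]
    · refine Finset.sum_congr rfl fun r hr => ?_
      have hr : r ≤ p := by have := Finset.mem_range.1 hr; lia
      have e0 : p + 1 - 1 - r = p - r := by lia
      have e1 : N + g + l + 1 + ((p : ℤ) - r) = N + g + p + l + 1 - r := by ring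
      have e2 (z : ℤ) : z - ((p : ℤ) - r) = z - p + r := by ring
      have e3 : (l : ℤ) - s + (p - r) = p - s + l - r := by ring
      have e4 : N - p - k + ((p : ℤ) - r) = N - k - r := by ring
      have e5 : g + ((p : ℤ) - r) = g + p - r := by ring
      have e6 : (-1 : ℝ) ^ p = (-1) ^ r * (-1) ^ (p - r) := by
        rw [← pow_add]; congr 1; lia
      have e7 : (-1 : ℝ) ^ r * (-1) ^ r = 1 := by rw [← mul_pow]; simp
      simp only [f]
      rw [e0, Nat.cast_sub hr, e1, e2, e2, e2, e3, e4, e5, e6, sub_self, zero_add]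
      linear_combination ((-1 : ℝ) ^ (p - r) * qfactZ q (N + g + p + l + 1 - r) *
        qfactInv q r * qfactInv q (p - s + l - r) * qfactInv q (g + p - r) * qfactInv q (p - r) *
        qfactInv q (N - k - r) * qfactInv q (k - p + r) * qfactInv q (s - p + r)) * e7
    · rintro n (hn | hn)
      · rw [qfactInv_of_neg q (n := p - s + l - n) (by lia)]; ring
      · rw [qfactInv_of_neg q (n := p - n) (by lia)]; ring
  have hQ : (-1) ^ k * Q1 = (-1) ^ p * Q2 := by
    rw [hQ1', hQ2']
    refine sum_range_eq_sum_range_of_eq_zero ?_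
    rintro n (hn | hn)
    · simp only [f]
      rw [qfactInv_of_neg q (n := k - n) (by lia)]; ring
    · simp only [f]
      rw [qfactInv_of_neg q (n := p - n) (by lia)]; ring
  have hZ := (qfactZ_pos hq hq1 (g + p + l + k + 1)).ne'
  apply mul_left_cancel₀ hZ
  linear_combination ((-1) ^ k * qfactZ q (l + k - s) * qfactZ q (N - k) * qfactZ q (g + s)) * h1 -
    ((-1) ^ p * qfactZ q (p - s + l) * qfactZ q (N - p) * qfactZ q s) * h2 +
    (qfactZ q (l + k - s) * qfactZ q (N - k) * qfactZ q (g + s) * qfactZ q (N - p) *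
      qfactZ q (g + k) * qfactZ q s * qfactZ q p * qfactZ q l * qfactZ q (p - s + l)) * hQ

lemma qfactQ_eq_qfactZ (q : ℝ) {x : ℚ} (n : ℤ) (h : x = n) : qfactQ q x = qfactZ q n := by
  rw [h, qfactQ, Int.floor_intCast, qfactZ]

lemma qnumQ_eq_qnum (q : ℝ) {x : ℚ} (n : ℤ) (h : x = n) : qnumQ q x = qnum q n := by
  rw [h, qnumQ, Int.floor_intCast]

/-- The q-Racah coefficient in terms of integer labels. -/
lemma URacah_eq (q : ℝ) {N g : ℤ} {k l s p a : ℕ}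
    (hg : 0 ≤ g) (hp : p ≤ N) (ha : (a : ℤ) = p - s + l)
    {T j1 j2 j3 U j : ℚ}
    (hT : 2 * T = g + p + s) (hj1 : 2 * j1 = N + g - p + s)
    (hj2 : 2 * j2 = g + p - s + l + k) (hj3 : 2 * j3 = l + k)
    (hU : 2 * U = N - k + l) (hj : 2 * j = N) :
    URacah q j1 j2 j j3 U T = (-1 : ℝ) ^ ((k : ℤ) - p) *
      √(qnum q (N - k + l + 1) * qnum q (g + p + s + 1) * qfactZ q (N + g + l + 1) *
          qfactZ q (g + p + l + k + 1) * qfactZ q (N - k - p + s) * qfactZ q (p - s + l) *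
          qfactZ q (N - p) * qfactZ q (g + p) * qfactZ q s * qfactZ q k /
        (qfactZ q (N + g + s + 1) * qfactZ q (N + l + 1) * qfactZ q (g + k) * qfactZ q (g + s) *
          qfactZ q (l + k - s) * qfactZ q l * qfactZ q (N - k) * qfactZ q p)) *
      ∑ n ∈ Finset.range (a + 1), (-1 : ℝ) ^ n * qfactZ q (g + p + l + k - s - n) *
        qfactZ q (g + p + l - n) * qfactZ q (N + g + p + l + 1 - n) * qfactInv q n *
        qfactInv q (p - s + l - n) * qfactInv q (g + p - n) *
        qfactInv q (g + p + l + k + 1 - n) * qfactInv q (N + g + l + 1 - n) := by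
  obtain rfl : T = (g + p + s) / 2 := by linarith
  obtain rfl : j1 = (N + g - p + s) / 2 := by linarith
  obtain rfl : j2 = (g + p - s + l + k) / 2 := by linarith
  obtain rfl : j3 = (l + k) / 2 := by linarith
  obtain rfl : U = (N - k + l) / 2 := by linarith
  obtain rfl : j = N / 2 := by linarith
  unfold URacah
  have c0 : (N + g - p + s : ℚ) / 2 + (l + k) / 2 - (N - k + l) / 2 - (g + p + s) / 2 =
    ((k - p : ℤ) : ℚ) := by push_cast; ring
  have c1 : 2 * ((g + p - s + l + k : ℚ) / 2) = ((g + p + l + k - s : ℤ) : ℚ) := by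
    push_cast; ring
  have c2 : (g + p - s + l + k : ℚ) / 2 + (N - k + l) / 2 - N / 2 + (g + p + s) / 2 =
    ((g + p + l : ℤ) : ℚ) := by push_cast; ring
  have c3 : (g + p - s + l + k : ℚ) / 2 + (N - k + l) / 2 + N / 2 + (g + p + s) / 2 + 1 =
    ((N + g + p + l + 1 : ℤ) : ℚ) := by push_cast; ring
  have c4 : -((N + g - p + s : ℚ) / 2) + (g + p - s + l + k) / 2 + (N - k + l) / 2 =
    ((p - s + l : ℤ) : ℚ) := by push_cast; ring
  have c5 : (g + p - s + l + k : ℚ) / 2 - (l + k) / 2 + (g + p + s) / 2 =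
    ((g + p : ℤ) : ℚ) := by push_cast; ring
  have c6 : (N + g - p + s : ℚ) / 2 + (g + p - s + l + k) / 2 + (N - k + l) / 2 + 1 =
    ((N + g + l + 1 : ℤ) : ℚ) := by push_cast; ring
  have c7 : (g + p - s + l + k : ℚ) / 2 + (l + k) / 2 + (g + p + s) / 2 + 1 =
    ((g + p + l + k + 1 : ℤ) : ℚ) := by push_cast; ring
  simp only [c0, c1, c2, c3, c4, c5, c6, c7, Int.floor_intCast]
  rw [qnumQ_eq_qnum q (N - k + l + 1) (by push_cast; ring),
    qnumQ_eq_qnum q (g + p + s + 1) (by push_cast; ring),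
    qfactQ_eq_qfactZ q (N + g + l + 1) rfl, qfactQ_eq_qfactZ q (g + p + l + k + 1) rfl,
    qfactQ_eq_qfactZ q (x := _ - _ + _) (N - k - p + s) (by push_cast; ring),
    qfactQ_eq_qfactZ q (p - s + l) rfl,
    qfactQ_eq_qfactZ q (x := _ + _ - _) (N - p) (by push_cast; ring),
    qfactQ_eq_qfactZ q (g + p) rfl,
    qfactQ_eq_qfactZ q (x := -_ + _ + _) s (by push_cast; ring),
    qfactQ_eq_qfactZ q (x := -_ + _ + _) k (by push_cast; ring),
    qfactQ_eq_qfactZ q (x := _ + _ + _ + 1) (N + g + s + 1) (by push_cast; ring),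
    qfactQ_eq_qfactZ q (x := _ + _ + _ + 1) (N + l + 1) (by push_cast; ring),
    qfactQ_eq_qfactZ q (x := _ + _ - _) (g + k) (by push_cast; ring),
    qfactQ_eq_qfactZ q (x := _ - _ + _) (g + s) (by push_cast; ring),
    qfactQ_eq_qfactZ q (x := _ + _ - _) (l + k - s) (by push_cast; ring),
    qfactQ_eq_qfactZ q (x := _ + _ - _) l (by push_cast; ring),
    qfactQ_eq_qfactZ q (x := _ - _ + _) (N - k) (by push_cast; ring),
    qfactQ_eq_qfactZ q (x := -_ + _ + _) p (by push_cast; ring)]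
  congr 1
  calc _ = ∑ n ∈ Finset.range ((g + p + l + k - s : ℤ).toNat + 1),
      (-1 : ℝ) ^ n * qfactZ q (g + p + l + k - s - n) *
        qfactZ q (g + p + l - n) * qfactZ q (N + g + p + l + 1 - n) * qfactInv q n *
        qfactInv q (p - s + l - n) * qfactInv q (g + p - n) *
        qfactInv q (g + p + l + k + 1 - n) * qfactInv q (N + g + l + 1 - n) := by
        refine Finset.sum_congr rfl fun n _ => ?_
        have e (z : ℤ) : (z : ℚ) - n = ((z - n : ℤ) : ℚ) := by push_cast; ring
        simp only [e, Int.cast_nonneg_iff]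
        split_ifs with h
        · obtain ⟨h1, h2, h3, h4, h5, h6, h7⟩ := h
          rw [qfactQ_eq_qfactZ q _ rfl, qfactQ_eq_qfactZ q _ rfl, qfactQ_eq_qfactZ q _ rfl,
            qfactQ_eq_qfactZ q _ rfl, qfactQ_eq_qfactZ q _ rfl, qfactQ_eq_qfactZ q _ rfl,
            qfactQ_eq_qfactZ q _ rfl, qfactInv_of_nonneg q h4, qfactInv_of_nonneg q h5,
            qfactInv_of_nonneg q h6, qfactInv_of_nonneg q h7,
            qfactInv_of_nonneg q (n := n) (by lia), qfactZ_natCast]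
          simp only [div_eq_mul_inv, mul_inv]
          ring
        · by_cases h4 : 0 ≤ (p : ℤ) - s + l - n
          · rw [qfactInv_of_neg q (n := g + p - n) (by lia)]; ring
          · rw [qfactInv_of_neg q (n := p - s + l - n) (by lia)]; ring
    _ = _ := by
        refine sum_range_eq_sum_range_of_eq_zero fun n hn => ?_
        rw [qfactInv_of_neg q (n := p - s + l - n) (by lia)]
        ring

/-- The q-Weyl coefficient in terms of the differences `N = f1 - f2` and `g = f2 - f3 - 2`. -/
lemma qWeyl_eq (q : ℝ) {f1 f2 f3 N g : ℤ} {k l s p : ℕ} (hN : f1 - f2 = N)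
    (hg' : f2 - f3 - 2 = g) (hg : 0 ≤ g) (hk : k ≤ N) (hlks : (s : ℤ) ≤ l + k) :
    qWeyl q f1 f2 f3 k l s p =
      √(qnum q (N - k + l + 1) * qnum q (g + p + s + 1) * qfactZ q k * qfactZ q (l + k - s) *
          qfactZ q (N - k - p + s) * qfactZ q (g + p + l + k + 1) * qfactZ q (N - k) *
          qfactZ q (N + l + 1) * qfactZ q (g + s) * qfactZ q (g + p) /
        (qfactZ q s * qfactZ q p * qfactZ q l * qfactZ q (p - s + l) *
          qfactZ q (N + g + s + 1) * qfactZ q (N - p) * qfactZ q (g + k) *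
          qfactZ q (N + g + l + 1))) *
      ((-1) ^ k * ∑ n ∈ Finset.range (k + 1), (-1 : ℝ) ^ n * qfactZ q (l + k - n) *
        qfactZ q (p - s + l + k - n) * qfactZ q (N + g + l + k + 1 - n) * qfactInv q n *
        qfactInv q (k - n) * qfactInv q (l + k - s - n) * qfactInv q (N + l + 1 - n) *
        qfactInv q (g + p + l + k + 1 - n)) := by
  obtain rfl : f3 = f2 - g - 2 := by lia
  obtain rfl : f1 = f2 + N := by lia
  have c1 : f2 + N - f2 = N := by ring
  have c2 : f2 - (f2 - g - 2) = g + 2 := by ring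
  have c3 : f2 + N - (f2 - g - 2) = N + g + 2 := by ring
  have c4 (z : ℤ) : g + 2 + z - 2 = g + z := by ring
  have c5 (z : ℤ) : N + g + 2 + z - 1 = N + g + z + 1 := by ring
  have c6 : g + 2 + p + s - 1 = g + p + s + 1 := by ring
  have c7 : g + 2 + p + l + k - 1 = g + p + l + k + 1 := by ring
  unfold qWeyl
  simp only [c1, c2, c3, c4, c5, c6, c7, ← qfactZ_natCast]
  congr 1
  rw [Finset.mul_sum]
  refine Eq.trans ?_
    (sum_range_eq_sum_range_of_eq_zero (A := min k (l + k - s) + 1) (B := k + 1) ?_)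
  · refine Finset.sum_congr rfl fun n hn => ?_
    have hn : n ≤ min k (l + k - s) := by have := Finset.mem_range.1 hn; lia
    have d1 : N + g + 2 + l + k - n - 1 = N + g + l + k + 1 - n := by ring
    have d2 : g + 2 + p + l + k - n - 1 = g + p + l + k + 1 - n := by ring
    rw [d1, d2, Nat.cast_sub (by lia : n ≤ k), qfactInv_of_nonneg q (n := n) (by lia),
      qfactInv_of_nonneg q (n := k - n) (by lia), qfactInv_of_nonneg q (n := l + k - s - n) (by lia),
      qfactInv_of_nonneg q (n := N + l + 1 - n) (by lia),
      qfactInv_of_nonneg q (n := g + p + l + k + 1 - n) (by lia), pow_add]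
    simp only [div_eq_mul_inv, mul_inv]
    ring
  · intro n hn
    by_cases h : n ≤ k
    · rw [qfactInv_of_neg q (n := l + k - s - n) (by lia)]; ring
    · rw [qfactInv_of_neg q (n := k - n) (by lia)]; ring

/-- The q-Weyl coefficient ⟨U|T⟩_q for the positive discrete series of u_q(2,1)
coincides, apart from the phase (−1)^k, with the q-Racah coefficient
U_q(j1 j2 j j3; U T) of su_q(2) (second equality in (117)). -/
theorem qWeyl_eq_racah_second
    (q : ℝ) (hq : 0 < q) (hq1 : q ≠ 1)
    (f1 f2 f3 : ℤ) (k l s p : ℕ)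
    (h23 : 2 ≤ f2 - f3) (hk : (k : ℤ) ≤ f1 - f2) (hp : (p : ℤ) ≤ f1 - f2)
    (hpls : (s : ℤ) ≤ (p : ℤ) + (l : ℤ)) (hlks : (s : ℤ) ≤ (l : ℤ) + (k : ℤ))
    (hkps : 0 ≤ f1 - f2 - (k : ℤ) - (p : ℤ) + (s : ℤ))
    (T j1 j2 j3 U j : ℚ)
    (hT : 2 * T = (f2 : ℚ) - (f3 : ℚ) + (p : ℚ) + (s : ℚ) - 2)
    (hj1 : 2 * j1 = (f1 : ℚ) - (f3 : ℚ) - (p : ℚ) + (s : ℚ) - 2)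
    (hj2 : 2 * j2 = (f2 : ℚ) - (f3 : ℚ) + (p : ℚ) - (s : ℚ) + (l : ℚ) + (k : ℚ) - 2)
    (hj3 : 2 * j3 = (l : ℚ) + (k : ℚ))
    (hU : 2 * U = (f1 : ℚ) - (f2 : ℚ) - (k : ℚ) + (l : ℚ))
    (hj : 2 * j = (f1 : ℚ) - (f2 : ℚ)) :
    qWeyl q f1 f2 f3 k l s p = (-1 : ℝ) ^ k * URacah q j1 j2 j j3 U T := by
  obtain ⟨a, ha⟩ : ∃ a : ℕ, (a : ℤ) = p - s + l := ⟨(p - s + l : ℤ).toNat, by lia⟩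
  obtain ⟨N, hN⟩ : ∃ N, f1 - f2 = N := ⟨_, rfl⟩
  obtain ⟨g, hg'⟩ : ∃ g, f2 - f3 - 2 = g := ⟨_, rfl⟩
  have hNQ : (f1 : ℚ) = f2 + N := by exact_mod_cast eq_add_of_sub_eq' hN
  have hgQ : (f2 : ℚ) = f3 + g + 2 := by
    have : f2 = f3 + g + 2 := by lia
    exact_mod_cast this
  have hg : 0 ≤ g := by lia
  rw [hN] at hk hp
  rw [qWeyl_eq q hN hg' hg hk hlks, URacah_eq q (k := k) (l := l) (s := s) (p := p) hg hp ha
    (by linarith) (by linarith) (by linarith) (by linarith) (by linarith) (by linarith)]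
  have key := weyl_sum_racah_sum hq hq1 hg hk hp ha hlks
  set W := ∑ n ∈ Finset.range (k + 1), (-1 : ℝ) ^ n * qfactZ q (l + k - n) *
        qfactZ q (p - s + l + k - n) * qfactZ q (N + g + l + k + 1 - n) * qfactInv q n *
        qfactInv q (k - n) * qfactInv q (l + k - s - n) * qfactInv q (N + l + 1 - n) *
        qfactInv q (g + p + l + k + 1 - n)
  set R := ∑ n ∈ Finset.range (a + 1), (-1 : ℝ) ^ n * qfactZ q (g + p + l + k - s - n) *
        qfactZ q (g + p + l - n) * qfactZ q (N + g + p + l + 1 - n) * qfactInv q n *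
        qfactInv q (p - s + l - n) * qfactInv q (g + p - n) *
        qfactInv q (g + p + l + k + 1 - n) * qfactInv q (N + g + l + 1 - n)
  have hpos := qfactZ_pos hq hq1
  have p1 := hpos (p - s + l)
  have p2 := hpos (N + g + l + 1)
  have p3 := hpos (N - p)
  have p4 := hpos s
  have p5 := hpos (l + k - s)
  have p6 := hpos (N - k)
  have p7 := hpos (N + l + 1)
  have p8 := hpos (g + s)
  have p9 := hpos (N + g + s + 1)
  have p10 := hpos (g + k)
  have p11 := hpos l
  have p12 := hpos p
  have hsign : (-1 : ℝ) ^ k * (-1 : ℝ) ^ ((k : ℤ) - p) = (-1) ^ p := by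
    rw [zpow_sub₀ (by norm_num), zpow_natCast, zpow_natCast, mul_div_assoc', ← mul_pow,
      div_eq_iff (by simp), ← mul_pow]
    simp
  set c := qfactZ q (l + k - s) * qfactZ q (N - k) * qfactZ q (N + l + 1) * qfactZ q (g + s) /
    (qfactZ q (p - s + l) * qfactZ q (N + g + l + 1) * qfactZ q (N - p) * qfactZ q s) with hc
  have hc0 : 0 ≤ c := by positivity
  have hcW : c * ((-1) ^ k * W) = (-1) ^ p * R := by
    rw [hc, div_mul_eq_mul_div, div_eq_iff (by positivity)]
    linear_combination key
  set X := qnum q (N - k + l + 1) * qnum q (g + p + s + 1) * qfactZ q (N + g + l + 1) *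
          qfactZ q (g + p + l + k + 1) * qfactZ q (N - k - p + s) * qfactZ q (p - s + l) *
          qfactZ q (N - p) * qfactZ q (g + p) * qfactZ q s * qfactZ q k /
        (qfactZ q (N + g + s + 1) * qfactZ q (N + l + 1) * qfactZ q (g + k) * qfactZ q (g + s) *
          qfactZ q (l + k - s) * qfactZ q l * qfactZ q (N - k) * qfactZ q p) with hX
  have hrad : qnum q (N - k + l + 1) * qnum q (g + p + s + 1) * qfactZ q k *
          qfactZ q (l + k - s) *
          qfactZ q (N - k - p + s) * qfactZ q (g + p + l + k + 1) * qfactZ q (N - k) *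
          qfactZ q (N + l + 1) * qfactZ q (g + s) * qfactZ q (g + p) /
        (qfactZ q s * qfactZ q p * qfactZ q l * qfactZ q (p - s + l) *
          qfactZ q (N + g + s + 1) * qfactZ q (N - p) * qfactZ q (g + k) *
          qfactZ q (N + g + l + 1)) = c ^ 2 * X := by
    rw [hc, hX]
    field_simp
  rw [hrad, Real.sqrt_mul (sq_nonneg c), Real.sqrt_sq hc0]
  linear_combination √X * hcW - √X * R * hsign
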